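/- arXiv:cs/0605026 — 3 statements merged into one kernel-verified Lean document; each statement's English description precedes it below -/
import Mathlib

section
/- If F is a finite automaton (Mealy machine) with input alphabet A and output alphabet B, and ω is an eventually strongly almost periodic sequence over A, then the output sequence F(ω) is eventually strongly almost periodic over B. -/
/-- The segment of a sequence `ω` of length `l` starting at position `i`,
i.e. the string `ω(i)ω(i+1)…ω(i+l-1)`. -/
def seg {A : Type*} (ω : ℕ → A) (i l : ℕ) : List A :=
  List.ofFn (fun k : Fin l => ω (i + k))

/-- The string `x` occurs in the sequence `ω` starting at position `i`. -/
def OccursAt {A : Type*} (ω : ℕ → A) (x : List A) (i : ℕ) : Prop :=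
  seg ω i x.length = x

/-- A sequence is strongly almost periodic if every string occurring in it
occurs in every segment of some fixed length `l`. -/
def StronglyAP {A : Type*} (ω : ℕ → A) : Prop :=
  ∀ x : List A, (∃ i, OccursAt ω x i) →
    ∃ l, ∀ i, ∃ j, i ≤ j ∧ j + x.length ≤ i + l ∧ OccursAt ω x j

/-- The sequence `aν` obtained by prepending the finite string `a` to the sequence `ν`. -/
def appendSeq {A : Type*} (a : List A) (ν : ℕ → A) : ℕ → A :=
  fun n => if h : n < a.length then a[n]'h else ν (n - a.length)

/-- A sequence is eventually strongly almost periodic if it equals `aν` for some finite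
string `a` and strongly almost periodic sequence `ν`. -/
def EventuallySAP {A : Type*} (ω : ℕ → A) : Prop :=
  ∃ (a : List A) (ν : ℕ → A), StronglyAP ν ∧ ω = appendSeq a ν

/-- The state of the automaton with translation function `f` and initial state `init`
before reading the `n`-th symbol of the input sequence `α`. -/
def autState {A Q B : Type*} (f : Q × A → Q × B) (init : Q) (α : ℕ → A) : ℕ → Q
  | 0 => init
  | n + 1 => (f (autState f init α n, α n)).1

/-- The output sequence of the finite automaton with translation function `f` and
initial state `init` on the input sequence `α`. -/
def autOutput {A Q B : Type*} (f : Q × A → Q × B) (init : Q) (α : ℕ → A) (n : ℕ) : B :=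
  (f (autState f init α n, α n)).2

theorem occursAt_iff {A : Type*} {ω : ℕ → A} {x : List A} {i : ℕ} :
    OccursAt ω x i ↔ ∀ (k : ℕ) (h : k < x.length), ω (i + k) = x[k] := by
  unfold OccursAt seg
  constructor
  · intro hx k h
    have hk := List.getElem_of_eq hx.symm h
    simpa using hk.symm
  · intro hx
    apply List.ext_getElem
    · simp
    · intro k _ h
      simpa using hx k h

theorem StronglyAP.shift {A : Type*} {ω : ℕ → A} (hω : StronglyAP ω) (m : ℕ) :
    StronglyAP (fun n => ω (m + n)) := by
  simp only [StronglyAP, occursAt_iff] at hω ⊢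
  rintro x ⟨i, hi⟩
  obtain ⟨l, hl⟩ := hω x ⟨m + i, fun k h => by rw [add_assoc, hi k h]⟩
  refine ⟨l, fun i => ?_⟩
  obtain ⟨j, hij, hjl, hj⟩ := hl (m + i)
  refine ⟨j - m, by omega, by omega, fun k h => ?_⟩
  rw [← hj k h]
  congr 1
  omega

theorem EventuallySAP.of_shift {A : Type*} {ω : ℕ → A} (m : ℕ)
    (h : StronglyAP (fun n => ω (m + n))) : EventuallySAP ω := by
  refine ⟨List.ofFn (fun k : Fin m => ω k), _, h, ?_⟩
  funext n
  unfold appendSeq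
  split_ifs with hn
  · simp
  · simp only [List.length_ofFn] at hn ⊢
    congr 1
    omega

/-- The prefix of `ω` of length `n` recurs at bounded distances in a strongly almost periodic
sequence `ω`. -/
theorem StronglyAP.exists_prefix_recurrence {A : Type*} {ω : ℕ → A} (hω : StronglyAP ω) (n : ℕ) :
    ∃ l, ∀ i, ∃ j, i ≤ j ∧ j ≤ i + l ∧ ∀ k < n, ω (j + k) = ω k := by
  simp only [StronglyAP, occursAt_iff] at hω
  obtain ⟨l, hl⟩ := hω (List.ofFn (fun k : Fin n => ω k)) ⟨0, fun k h => by simp⟩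
  refine ⟨l, fun i => ?_⟩
  obtain ⟨j, hij, hjl, hj⟩ := hl i
  refine ⟨j, hij, by omega, fun k hk => ?_⟩
  rw [hj k (by simpa using hk), List.getElem_ofFn]

theorem autState_add {A Q B : Type*} (f : Q × A → Q × B) (q : Q) (α : ℕ → A) (m n : ℕ) :
    autState f q α (m + n) = autState f (autState f q α m) (fun k => α (m + k)) n := by
  induction n with
  | zero => rfl
  | succ n ih => rw [← add_assoc, autState, autState, ih]

theorem autState_congr {A Q B : Type*} (f : Q × A → Q × B) (q : Q) {α β : ℕ → A} {n : ℕ}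
    (h : ∀ k < n, α k = β k) : autState f q α n = autState f q β n := by
  induction n with
  | zero => rfl
  | succ n ih => rw [autState, autState, ih fun k hk => h k (by omega), h n (by omega)]

theorem autState_add_of_prefix {A Q B : Type*} (f : Q × A → Q × B) (q : Q) {ω : ℕ → A} {j n : ℕ}
    (h : ∀ k < n, ω (j + k) = ω k) :
    autState f q ω (j + n) = autState f (autState f q ω j) ω n := by
  rw [autState_add, autState_congr f _ h]

theorem autOutput_add {A Q B : Type*} (f : Q × A → Q × B) (q : Q) (α : ℕ → A) (m n : ℕ) :
    autOutput f q α (m + n) = autOutput f (autState f q α m) (fun k => α (m + k)) n := by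
  rw [autOutput, autOutput, autState_add]

/-- The transformations of the state set induced by initial segments of `ω` that are followed by
arbitrarily long prefixes of `ω`. -/
def recurrentMaps {A Q B : Type*} (f : Q × A → Q × B) (ω : ℕ → A) :
    Submonoid (Function.End Q) where
  carrier := {g | ∀ n, ∃ j, (∀ k < n, ω (j + k) = ω k) ∧ ∀ q, autState f q ω j = g q}
  one_mem' := fun _ => ⟨0, fun k _ => by rw [zero_add], fun _ => rfl⟩
  mul_mem' := by
    intro g h hg hh n
    obtain ⟨i, hi, hgi⟩ := hg n
    obtain ⟨j, hj, hhj⟩ := hh (i + n)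
    refine ⟨j + i, fun k hk => ?_, fun q => ?_⟩
    · rw [add_assoc, hj _ (by omega), hi k hk]
    · rw [autState_add_of_prefix f q fun k hk => hj k (by omega), hhj, hgi]
      rfl

theorem exists_isIdempotentElem_pow {M : Type*} [Monoid M] [Finite M] (x : M) :
    ∃ n, IsIdempotentElem (x ^ (n + 1)) := by
  obtain ⟨a, b, hab, h⟩ := Finite.exists_ne_map_eq_of_infinite (fun n : ℕ => x ^ n)
  wlog hlt : a < b generalizing a b
  · exact this b a hab.symm h.symm (by omega)
  obtain ⟨d, rfl⟩ := Nat.exists_eq_add_of_lt hlt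
  have step : ∀ t, x ^ (a + t) = x ^ (a + t + (d + 1)) := fun t => by
    have h' : x ^ a = x ^ (a + d + 1) := h
    rw [pow_add, h', ← pow_add]
    congr 1
    ring
  have iter : ∀ c t, x ^ (a + t) = x ^ (a + t + c * (d + 1)) := fun c t => by
    induction c with
    | zero => simp
    | succ c ih =>
      rw [ih, add_assoc, step, add_assoc]
      congr 1
      ring
  refine ⟨(a + 1) * (d + 1) - 1, ?_⟩
  have hpos : (a + 1) * (d + 1) - 1 + 1 = (a + 1) * (d + 1) := Nat.sub_add_cancel (Nat.mul_pos a.succ_pos d.succ_pos)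
  obtain ⟨t, ht⟩ : ∃ t, (a + 1) * (d + 1) = a + t :=
    Nat.exists_eq_add_of_le (by nlinarith [Nat.zero_le (a * d)])
  rw [hpos, IsIdempotentElem, ← pow_add]
  have hperiod := iter (a + 1) t
  rw [← ht] at hperiod
  exact hperiod.symm

/-- A monoid of transformations of a finite set contains an idempotent generating a minimal left
ideal. -/
theorem Submonoid.exists_minimal_idempotent {Q : Type*} [Finite Q]
    (M : Submonoid (Function.End Q)) :
    ∃ e ∈ M, e * e = e ∧ ∀ g ∈ M, ∃ h ∈ M, h * g * e = e := by
  have : Finite (Function.End Q) := inferInstanceAs (Finite (Q → Q))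
  obtain ⟨τ, hτ, hmin⟩ := Set.exists_min_image (M : Set (Function.End Q))
    (fun g => (Set.range g).ncard) (Set.toFinite _) ⟨1, M.one_mem⟩
  obtain ⟨n, hn⟩ := exists_isIdempotentElem_pow τ
  have range_mul : ∀ g h : Function.End Q, Set.range (g * h : Function.End Q) ⊆ Set.range g :=
    fun g h => Set.range_comp_subset_range h g
  refine ⟨τ ^ (n + 1), M.pow_mem hτ _, hn, fun g hg => ?_⟩
  have he : τ ^ (n + 1) ∈ M := M.pow_mem hτ _
  have hle : (Set.range (τ ^ (n + 1) : Function.End Q)).ncard ≤ (Set.range τ).ncard := by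
    rw [pow_succ']
    exact Set.ncard_le_ncard (range_mul _ _)
  generalize τ ^ (n + 1) = e at hn he hle
  obtain ⟨m, hm⟩ := exists_isIdempotentElem_pow (e * g)
  have hege : (e * g) ^ (m + 1) ∈ M := M.pow_mem (M.mul_mem he hg) _
  have hsub : Set.range ((e * g) ^ (m + 1) : Function.End Q) ⊆ Set.range e := by
    rw [pow_succ', mul_assoc]
    exact range_mul _ _
  have hrange := Set.eq_of_subset_of_ncard_le hsub (hle.trans (hmin _ hege))
  refine ⟨(e * g) ^ m * e, M.mul_mem (M.pow_mem (M.mul_mem he hg) _) he, ?_⟩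
  rw [mul_assoc (_ ^ m), ← pow_succ]
  funext q
  obtain ⟨r, hr⟩ : e q ∈ Set.range ((e * g) ^ (m + 1) : Function.End Q) :=
    hrange ▸ Set.mem_range_self q
  change ((e * g) ^ (m + 1) : Function.End Q) (e q) = e q
  rw [← hr]
  exact congrFun hm r

theorem exists_prefix_forall_mem_recurrentMaps {A Q B : Type*} [Finite Q] (f : Q × A → Q × B)
    (ω : ℕ → A) :
    ∃ n, ∀ j, (∀ k < n, ω (j + k) = ω k) →
      (fun q => autState f q ω j : Function.End Q) ∈ recurrentMaps f ω := by
  have : Finite (Function.End Q) := inferInstanceAs (Finite (Q → Q))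
  have hbad : ∀ g : Function.End Q, ∃ n, ∀ j, (∀ k < n, ω (j + k) = ω k) →
      (∀ q, autState f q ω j = g q) → g ∈ recurrentMaps f ω := by
    intro g
    by_cases hg : g ∈ recurrentMaps f ω
    · exact ⟨0, fun _ _ _ => hg⟩
    · have hg' : ¬ ∀ n, ∃ j, (∀ k < n, ω (j + k) = ω k) ∧ ∀ q, autState f q ω j = g q := hg
      push Not at hg'
      obtain ⟨n, hn⟩ := hg'
      refine ⟨n, fun j hj hq => ?_⟩
      obtain ⟨q, hne⟩ := hn j hj
      exact absurd (hq q) hne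
  choose n hn using hbad
  obtain ⟨N, hN⟩ := Finite.exists_le n
  exact ⟨N, fun j hj => hn _ j (fun k hk => hj k (hk.trans_le (hN _))) fun _ => rfl⟩

theorem StronglyAP.autOutput_of_return {A Q B : Type*} [Finite Q] {f : Q × A → Q × B} {ω : ℕ → A}
    (hω : StronglyAP ω) {s : Q}
    (hs : ∀ g ∈ recurrentMaps f ω, ∃ h ∈ recurrentMaps f ω, h (g s) = s) :
    StronglyAP (autOutput f s ω) := by
  have : Finite (Function.End Q) := inferInstanceAs (Finite (Q → Q))
  simp only [StronglyAP, occursAt_iff]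
  rintro x ⟨i₀, hx⟩
  obtain ⟨n, hn⟩ := exists_prefix_forall_mem_recurrentMaps f ω
  have hret : ∀ h : recurrentMaps f ω, ∃ i,
      (∀ k < i₀ + x.length, ω (i + k) = ω k) ∧ ∀ q, autState f q ω i = h.1 q :=
    fun h => h.2 _
  choose r hr hrs using hret
  obtain ⟨R, hR⟩ := Finite.exists_le r
  obtain ⟨l, hl⟩ := hω.exists_prefix_recurrence (n + (R + (i₀ + x.length)))
  refine ⟨l + R + i₀ + x.length, fun i => ?_⟩
  obtain ⟨j, hij, hjl, hj⟩ := hl i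
  obtain ⟨h, hh, hgs⟩ := hs _ (hn j fun k hk => hj k (by omega))
  have hle := hR ⟨h, hh⟩
  have hpre := hr ⟨h, hh⟩
  have hst := hrs ⟨h, hh⟩
  generalize r ⟨h, hh⟩ = t at hle hpre hst
  have hstate : autState f s ω (j + t) = s := by
    rw [autState_add_of_prefix f s fun k hk => hj k (by omega), hst]
    exact hgs
  have hagree : ∀ k < i₀ + x.length, ω (j + t + k) = ω k := fun k hk => by
    rw [add_assoc, hj _ (by omega), hpre k hk]
  refine ⟨j + t + i₀, by omega, by omega, fun k hk => ?_⟩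
  rw [← hx k hk, add_assoc (j + t), autOutput, autOutput, hagree _ (by omega),
    autState_add_of_prefix f s fun k' hk' => hagree k' (by omega), hstate]

theorem StronglyAP.exists_autOutput_shift {A Q B : Type*} [Finite Q] (f : Q × A → Q × B) (q : Q)
    {ω : ℕ → A} (hω : StronglyAP ω) :
    ∃ m, StronglyAP (fun n => autOutput f q ω (m + n)) := by
  obtain ⟨e, he, hee, hmin⟩ := (recurrentMaps f ω).exists_minimal_idempotent
  have hs : StronglyAP (autOutput f (e q) ω) := by
    refine hω.autOutput_of_return fun g hg => ?_
    obtain ⟨h, hh, hhe⟩ := hmin g hg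
    exact ⟨h, hh, congrFun hhe q⟩
  obtain ⟨j, -, hj⟩ := he 0
  have hmerge : autState f q ω j = autState f (e q) ω j := by
    rw [hj, hj]
    exact (congrFun hee q).symm
  refine ⟨j, ?_⟩
  simpa only [autOutput_add, hmerge] using hs.shift j

/-- If `F` is a finite automaton with input alphabet `A` and output alphabet `B`, and `ω`
is an eventually strongly almost periodic sequence over `A`, then the output `F(ω)` is an
eventually strongly almost periodic sequence over `B`. -/
theorem automaton_preserves_eventuallySAP {A B : Type*} [Fintype A] [Fintype B]
    (Q : Type*) [Fintype Q] (f : Q × A → Q × B) (init : Q)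
    (ω : ℕ → A) (hω : EventuallySAP ω) :
    EventuallySAP (autOutput f init ω) := by
  obtain ⟨a, ν, hν, rfl⟩ := hω
  obtain ⟨m, hm⟩ := hν.exists_autOutput_shift f (autState f init (appendSeq a ν) a.length)
  have htail : (fun k => appendSeq a ν (a.length + k)) = ν := by
    funext k
    simp [appendSeq]
  refine EventuallySAP.of_shift (a.length + m) ?_
  simpa only [add_assoc, autOutput_add f init _ a.length, htail] using hm
end

section
/- There exists a binary sequence ω (over the alphabet {0,1}) that is almost periodic but not eventually strongly almost periodic. -/
/-- A sequence is almost periodic if every string occurring in it infinitely many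
times occurs in every segment of some fixed length `l`. -/
def AlmostPeriodic {A : Type*} (ω : ℕ → A) : Prop :=
  ∀ x : List A, (∀ N, ∃ i, N ≤ i ∧ OccursAt ω x i) →
    ∃ l, ∀ i, ∃ j, i ≤ j ∧ j + x.length ≤ i + l ∧ OccursAt ω x j

theorem seg_eq_seg_iff {A : Type*} (ω ν : ℕ → A) (i j l : ℕ) :
    seg ω i l = seg ν j l ↔ ∀ t < l, ω (i + t) = ν (j + t) := by
  simp [seg, List.ofFn_inj, funext_iff, Fin.forall_iff]

theorem length_seg {A : Type*} (ω : ℕ → A) (i l : ℕ) : (seg ω i l).length = l := by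
  simp [seg]

/-- The parity of the 2-adic valuation, with the value flipped at the powers of two. -/
def flippedPeriodDoubling (n : ℕ) : Bool :=
  xor (decide (Odd (padicValNat 2 n))) (decide (n = 2 ^ padicValNat 2 n))

theorem padicValNat_two_pow_mul_odd (j q : ℕ) : padicValNat 2 (2 ^ j * (2 * q + 1)) = j := by
  rw [padicValNat.mul (by positivity) (by omega), padicValNat.prime_pow,
    padicValNat.eq_zero_of_not_dvd (by omega), add_zero]

theorem flippedPeriodDoubling_two_pow (k : ℕ) :
    flippedPeriodDoubling (2 ^ k) = !decide (Odd k) := by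
  simp [flippedPeriodDoubling]

theorem flippedPeriodDoubling_two_pow_mul_odd (j : ℕ) {q : ℕ} (hq : 1 ≤ q) :
    flippedPeriodDoubling (2 ^ j * (2 * q + 1)) = decide (Odd j) := by
  have h : 2 ^ j * (2 * q + 1) ≠ 2 ^ j := by
    have := Nat.two_pow_pos j
    nlinarith
  rw [flippedPeriodDoubling, padicValNat_two_pow_mul_odd]
  simp [h]

theorem flippedPeriodDoubling_eq_of_modEq {m n n' : ℕ} (hn : 2 ^ m < n) (hn' : 2 ^ m < n')
    (hdvd : ¬ 2 ^ m ∣ n) (h : n ≡ n' [MOD 2 ^ m]) :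
    flippedPeriodDoubling n = flippedPeriodDoubling n' := by
  obtain ⟨j, _, ⟨q, rfl⟩, rfl⟩ := Nat.exists_eq_two_pow_mul_odd (n := n) (by omega)
  have hj : j < m := by
    by_contra! hmj
    exact hdvd ((pow_dvd_pow 2 hmj).mul_right _)
  obtain ⟨d, rfl⟩ : ∃ d, m = j + 1 + d := ⟨m - (j + 1), by omega⟩
  have hlt : 2 ^ j < 2 ^ (j + 1 + d) := Nat.pow_lt_pow_right (by norm_num) (by omega)
  have h2 := h.of_dvd (pow_dvd_pow 2 (by omega : j + 1 ≤ j + 1 + d))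
  obtain ⟨p, rfl⟩ : 2 ^ j ∣ n' :=
    ((h2.of_dvd (pow_dvd_pow 2 (by omega : j ≤ j + 1))).dvd_iff dvd_rfl).1 (dvd_mul_right _ _)
  have h3 : 2 * q + 1 ≡ p [MOD 2] :=
    Nat.ModEq.mul_left_cancel' (c := 2 ^ j) (by positivity) (by rwa [pow_succ] at h2)
  obtain ⟨r, rfl⟩ : ∃ r, p = 2 * r + 1 := ⟨p / 2, by unfold Nat.ModEq at h3; omega⟩
  have hq : 1 ≤ q := by
    by_contra! h0
    obtain rfl : q = 0 := by omega
    omega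
  have hr : 1 ≤ r := by
    by_contra! h0
    obtain rfl : r = 0 := by omega
    omega
  rw [flippedPeriodDoubling_two_pow_mul_odd j hq, flippedPeriodDoubling_two_pow_mul_odd j hr]

/-- Every value is attained on a residue class modulo `2 ^ (m + 2)` consisting of multiples
of `2 ^ m`. -/
theorem exists_flippedPeriodDoubling_eq (m : ℕ) (b : Bool) :
    ∃ r, 2 ^ m ∣ r ∧ 0 < r ∧ r ≤ 2 ^ (m + 2) ∧
      ∀ s, 1 ≤ s → flippedPeriodDoubling (2 ^ (m + 2) * s + r) = b := by
  have hpos := Nat.two_pow_pos m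
  by_cases hb : decide (Odd m) = b
  · refine ⟨2 ^ m, dvd_rfl, hpos, by rw [pow_add]; omega, fun s hs => ?_⟩
    rw [show 2 ^ (m + 2) * s + 2 ^ m = 2 ^ m * (2 * (2 * s) + 1) by ring,
      flippedPeriodDoubling_two_pow_mul_odd m (by omega), hb]
  · refine ⟨2 ^ (m + 1), pow_dvd_pow 2 (by omega), by positivity,
      Nat.pow_le_pow_right (by norm_num) (by omega), fun s hs => ?_⟩
    rw [show 2 ^ (m + 2) * s + 2 ^ (m + 1) = 2 ^ (m + 1) * (2 * s + 1) by ring,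
      flippedPeriodDoubling_two_pow_mul_odd (m + 1) hs]
    cases b <;> simp_all [Nat.odd_add_one]

theorem almostPeriodic_flippedPeriodDoubling : AlmostPeriodic flippedPeriodDoubling := by
  intro x hx
  obtain ⟨m, hm⟩ : ∃ m, x.length ≤ 2 ^ m := ⟨x.length, Nat.lt_two_pow_self.le⟩
  obtain ⟨i, hi, hocc⟩ := hx (2 ^ m + 1)
  have hpos := Nat.two_pow_pos m
  obtain ⟨t, ht, htd⟩ : ∃ t < 2 ^ m, 2 ^ m ∣ i + t := by
    refine ⟨2 ^ m - 1 - (i + (2 ^ m - 1)) % 2 ^ m, by omega,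
      (i + (2 ^ m - 1)) / 2 ^ m, ?_⟩
    have := Nat.div_add_mod (i + (2 ^ m - 1)) (2 ^ m)
    have := Nat.mod_lt (i + (2 ^ m - 1)) hpos
    omega
  obtain ⟨r, hrd, hr0, hr, hval⟩ :=
    exists_flippedPeriodDoubling_eq m (flippedPeriodDoubling (i + t))
  have h4 : 2 ^ (m + 2) = 4 * 2 ^ m := by ring
  refine ⟨3 * 2 ^ (m + 2) + x.length, fun i₀ => ?_⟩
  have hdiv := Nat.div_add_mod i₀ (2 ^ (m + 2))
  have hlt := Nat.mod_lt i₀ (Nat.two_pow_pos (m + 2))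
  set s := i₀ / 2 ^ (m + 2) + 2 with hs
  have hmul : 2 ^ (m + 2) * s = 2 ^ (m + 2) * (i₀ / 2 ^ (m + 2)) + 2 * 2 ^ (m + 2) := by
    rw [hs]; ring
  have hdvd' : 2 ^ m ∣ 2 ^ (m + 2) * s + r :=
    dvd_add ((pow_dvd_pow 2 (by omega)).mul_right _) hrd
  refine ⟨2 ^ (m + 2) * s + r - t, by omega, by omega, ?_⟩
  unfold OccursAt at hocc ⊢
  rw [← hocc, length_seg, seg_eq_seg_iff]
  intro u hu
  by_cases hut : u = t
  · subst hut
    rw [Nat.sub_add_cancel (by omega), hval s (Nat.le_add_left 1 _)]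
  · have hmod : i + u ≡ 2 ^ (m + 2) * s + r - t + u [MOD 2 ^ m] := by
      have h0 : i + t ≡ 2 ^ (m + 2) * s + r - t + t [MOD 2 ^ m] := by
        rw [Nat.sub_add_cancel (by omega)]
        exact (Nat.modEq_zero_iff_dvd.2 htd).trans (Nat.modEq_zero_iff_dvd.2 hdvd').symm
      exact h0.add_right_cancel' t |>.add_right u
    refine (flippedPeriodDoubling_eq_of_modEq (by omega) (by omega) (fun hd => ?_) hmod).symm
    have h1 : t ≡ u [MOD 2 ^ m] :=
      ((Nat.modEq_zero_iff_dvd.2 htd).trans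
        (Nat.modEq_zero_iff_dvd.2 hd).symm).add_left_cancel' i
    exact hut (h1.eq_of_lt_of_lt ht (by omega)).symm

/-- The string on `[2 ^ k, 8 * 2 ^ k)` does not reoccur further to the right. -/
theorem flippedPeriodDoubling_shift_eq_zero {k d : ℕ}
    (h : ∀ n, 2 ^ k ≤ n → n < 8 * 2 ^ k →
      flippedPeriodDoubling (n + d) = flippedPeriodDoubling n) : d = 0 := by
  by_contra hd
  obtain ⟨j, _, ⟨e, rfl⟩, rfl⟩ := Nat.exists_eq_two_pow_mul_odd hd
  have hpos := Nat.two_pow_pos j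
  by_cases hjk : j ≤ k
  · obtain ⟨c, rfl⟩ := Nat.exists_eq_add_of_le hjk
    have hc := Nat.two_pow_pos c
    obtain ⟨a, ha, f, hf⟩ : ∃ a ≤ 1, ∃ f, e + a = 2 * f := by
      rcases Nat.even_or_odd' e with ⟨f, hf | hf⟩
      · exact ⟨0, by omega, f, by omega⟩
      · exact ⟨1, by omega, f + 1, by omega⟩
    have hb := h (2 ^ j * (2 * (2 * 2 ^ c + a) + 1)) (by rw [pow_add]; nlinarith)
      (by rw [pow_add]; nlinarith)
    rw [show 2 ^ j * (2 * (2 * 2 ^ c + a) + 1) + 2 ^ j * (2 * e + 1)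
        = 2 ^ (j + 1) * (2 * (2 ^ c + f) + 1) by
          rw [show 2 * e = 2 * (e + a) - 2 * a by omega, hf]
          zify [show 2 * a ≤ 2 * (2 * f) by omega]
          ring,
      flippedPeriodDoubling_two_pow_mul_odd _ (by omega),
      flippedPeriodDoubling_two_pow_mul_odd _ (by omega)] at hb
    rw [decide_eq_decide, Nat.odd_add_one] at hb
    exact not_iff_self hb
  · obtain ⟨c, rfl⟩ : ∃ c, j = k + 1 + c := ⟨j - (k + 1), by omega⟩
    have hk := Nat.two_pow_pos k
    have hb := h (2 ^ k) le_rfl (by omega)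
    rw [show 2 ^ k + 2 ^ (k + 1 + c) * (2 * e + 1) = 2 ^ k * (2 * (2 ^ c * (2 * e + 1)) + 1) by
        ring,
      flippedPeriodDoubling_two_pow_mul_odd _ (Nat.mul_pos (by positivity) (by omega)),
      flippedPeriodDoubling_two_pow] at hb
    simp at hb

theorem not_eventuallySAP_flippedPeriodDoubling : ¬ EventuallySAP flippedPeriodDoubling := by
  rintro ⟨a, ν, hν, hω⟩
  have hν' : ∀ n, ν n = flippedPeriodDoubling (a.length + n) := by
    intro n
    rw [hω]
    simp [appendSeq]
  set k := a.length with hk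
  have hlt : k < 2 ^ k := Nat.lt_two_pow_self
  obtain ⟨l, hl⟩ := hν (seg ν (2 ^ k - k) (7 * 2 ^ k))
    ⟨2 ^ k - k, by rw [OccursAt, length_seg]⟩
  obtain ⟨i, hi, -, hocc⟩ := hl (2 ^ k + 1)
  rw [OccursAt, length_seg, seg_eq_seg_iff] at hocc
  have hzero : k + i - 2 ^ k = 0 := by
    refine flippedPeriodDoubling_shift_eq_zero (k := k) fun n hn hn' => ?_
    have := hocc (n - 2 ^ k) (by omega)
    rw [hν', hν'] at this
    convert this using 2 <;> omega
  omega

/-- There exists a binary sequence which is almost periodic but not eventually strongly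
almost periodic. -/
theorem exists_almostPeriodic_not_eventuallySAP :
    ∃ ω : ℕ → Bool, AlmostPeriodic ω ∧ ¬ EventuallySAP ω := by
  exact ⟨flippedPeriodDoubling, almostPeriodic_flippedPeriodDoubling,
    not_eventuallySAP_flippedPeriodDoubling⟩
end

section
/- Define binary strings by a₀ = 1 and a_{n+1} = aₙ āₙ āₙ aₙ aₙ, where x̄ denotes the bitwise complement of x. Let cₙ be the concatenation of 10 copies of aₙ, let ω = c₀c₁c₂c₃…, and let l_{n+1} = (5/2)(5^{n+1} − 1) = |c₀c₁…cₙ|. Then for every n > 0, the string cₙ has no occurrence in ω beginning at any position ≥ l_{n+1}. -/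
/-- The bitwise complement of a binary string: every `0` is changed to `1` and vice versa. -/
def bcomp (x : List Bool) : List Bool := x.map (fun b => !b)

/-- The strings `a₀ = 1`, `a_{n+1} = aₙ āₙ āₙ aₙ aₙ`. -/
def aStr : ℕ → List Bool
  | 0 => [true]
  | n + 1 => aStr n ++ bcomp (aStr n) ++ bcomp (aStr n) ++ aStr n ++ aStr n

/-- The string `cₙ`: the concatenation of 10 copies of `aₙ`. -/
def cStr (n : ℕ) : List Bool := (List.replicate 10 (aStr n)).flatten

/-- The finite prefix `c₀c₁…c_{n-1}` of `ω`; its length is `lₙ = (5/2)(5ⁿ − 1)`. -/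
def prefixStr (n : ℕ) : List Bool := (List.ofFn fun k : Fin n => cStr k).flatten

/-- The sequence `ω = c₀c₁c₂c₃…` (the `m`-th symbol lies in the prefix
`c₀…c_m`, which has length greater than `m`). -/
def omegaSeq (m : ℕ) : Bool := (prefixStr (m + 1)).getD m false

theorem length_bcomp (x : List Bool) : (bcomp x).length = x.length := by
  simp [bcomp]

theorem length_aStr (n : ℕ) : (aStr n).length = 5 ^ n := by
  induction n with
  | zero => rfl
  | succ n ih =>
    simp only [aStr, List.length_append, length_bcomp, ih]
    ring

theorem length_flatten_replicate {α : Type*} (m : ℕ) (x : List α) :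
    (List.replicate m x).flatten.length = m * x.length := by
  rw [List.length_flatten, List.map_replicate, List.sum_replicate, smul_eq_mul]

theorem length_cStr (n : ℕ) : (cStr n).length = 10 * 5 ^ n := by
  rw [cStr, length_flatten_replicate, length_aStr]

theorem prefixStr_succ (n : ℕ) : prefixStr (n + 1) = prefixStr n ++ cStr n := by
  rw [prefixStr, List.ofFn_succ_last, List.flatten_append, List.flatten_singleton]
  rfl

theorem prefixStr_prefix {m k : ℕ} (h : m ≤ k) : prefixStr m <+: prefixStr k := by
  induction k, h using Nat.le_induction with
  | base => exact List.prefix_rfl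
  | succ k _ ih => exact ih.trans (prefixStr_succ k ▸ List.prefix_append _ _)

theorem le_length_prefixStr (n : ℕ) : n ≤ (prefixStr n).length := by
  induction n with
  | zero => simp
  | succ n ih =>
    rw [prefixStr_succ, List.length_append, length_cStr]
    have : 0 < 5 ^ n := by positivity
    omega

theorem getElem?_prefixStr {m j : ℕ} (h : j < m) : (prefixStr m)[j]? = some (omegaSeq j) := by
  have hj : j < (prefixStr (j + 1)).length := le_length_prefixStr (j + 1)
  obtain ⟨y, hy⟩ := prefixStr_prefix (Nat.succ_le_of_lt h)
  rw [← hy, List.getElem?_append_left hj, omegaSeq, List.getD_eq_getElem _ _ hj,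
    List.getElem?_eq_getElem hj]

/-- The length of `x` is a multiple of `5 * p`, and the symbol `p` places after any position
divisible by `5 * p` is the complement of the symbol at that position. -/
def FlipsAt (p : ℕ) (x : List Bool) : Prop :=
  5 * p ∣ x.length ∧ ∀ t, 5 * p * t < x.length → x[5 * p * t + p]? = x[5 * p * t]?.map (!·)

theorem FlipsAt.nil (p : ℕ) : FlipsAt p [] := by
  simp [FlipsAt]

theorem FlipsAt.bcomp {p : ℕ} {x : List Bool} (h : FlipsAt p x) : FlipsAt p (bcomp x) := by
  refine ⟨by simpa only [length_bcomp] using h.1, fun t ht => ?_⟩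
  rw [length_bcomp] at ht
  simp [_root_.bcomp, h.2 t ht]

theorem FlipsAt.append {p : ℕ} (hp : 0 < p) {x y : List Bool} (hx : FlipsAt p x)
    (hy : FlipsAt p y) : FlipsAt p (x ++ y) := by
  refine ⟨by simpa only [List.length_append] using dvd_add hx.1 hy.1, fun t ht => ?_⟩
  obtain ⟨s, hs⟩ := hx.1
  rw [List.length_append] at ht
  rcases lt_or_ge t s with h | h
  · have h1 : 5 * p * (t + 1) ≤ 5 * p * s := Nat.mul_le_mul_left _ h
    rw [mul_add] at h1
    rw [List.getElem?_append_left (by omega), List.getElem?_append_left (by omega),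
      hx.2 t (by omega)]
  · obtain ⟨u, rfl⟩ := Nat.exists_eq_add_of_le h
    rw [mul_add] at ht ⊢
    rw [List.getElem?_append_right (by omega), List.getElem?_append_right (by omega), hs,
      add_assoc, Nat.add_sub_cancel_left, Nat.add_sub_cancel_left, hy.2 u (by omega)]

theorem flipsAt_aStr {n k : ℕ} (h : n + 1 ≤ k) : FlipsAt (5 ^ n) (aStr k) := by
  have hp : 0 < 5 ^ n := by positivity
  induction k, h using Nat.le_induction with
  | base =>
    have hl : (aStr (n + 1)).length = 5 * 5 ^ n := by rw [length_aStr]; ring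
    refine ⟨hl ▸ dvd_rfl, fun t ht => ?_⟩
    have ht0 : t = 0 := by
      rw [hl] at ht
      exact Nat.lt_one_iff.1 (Nat.lt_of_mul_lt_mul_left (ht.trans_eq (mul_one _).symm))
    subst ht0
    simp only [aStr, List.append_assoc, mul_zero, zero_add]
    rw [List.getElem?_append_right (length_aStr n).le, length_aStr, Nat.sub_self,
      List.getElem?_append_left (by rw [length_bcomp, length_aStr]; exact hp),
      List.getElem?_append_left (by rw [length_aStr]; exact hp)]
    simp [bcomp]
  | succ k _ ih => exact .append hp (.append hp (.append hp (.append hp ih ih.bcomp) ih.bcomp) ih) ih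

theorem flipsAt_cStr {n k : ℕ} (h : n + 1 ≤ k) : FlipsAt (5 ^ n) (cStr k) := by
  have (m : ℕ) : FlipsAt (5 ^ n) (List.replicate m (aStr k)).flatten := by
    induction m with
    | zero => exact FlipsAt.nil _
    | succ m ih => exact (flipsAt_aStr h).append (by positivity) ih
  exact this 10

theorem exists_prefixStr_eq_append {n m : ℕ} (h : n + 1 ≤ m) :
    ∃ y, prefixStr m = prefixStr (n + 1) ++ y ∧ FlipsAt (5 ^ n) y := by
  induction m, h using Nat.le_induction with
  | base => exact ⟨[], by simp, FlipsAt.nil _⟩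
  | succ k hk ih =>
    obtain ⟨y, hy, hf⟩ := ih
    exact ⟨y ++ cStr k, by rw [prefixStr_succ, hy, List.append_assoc],
      hf.append (by positivity) (flipsAt_cStr hk)⟩

theorem omegaSeq_add_pow (n t : ℕ) :
    omegaSeq ((prefixStr (n + 1)).length + (5 * 5 ^ n * t + 5 ^ n)) =
      !omegaSeq ((prefixStr (n + 1)).length + 5 * 5 ^ n * t) := by
  have hp : 0 < 5 ^ n := by positivity
  set l := (prefixStr (n + 1)).length with hl
  set m := n + 1 + (l + (5 * 5 ^ n * t + 5 ^ n)) + 1 with hm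
  obtain ⟨y, hy, hf⟩ := exists_prefixStr_eq_append (show n + 1 ≤ m by omega)
  have key (j : ℕ) (hj : l + j < m) : y[j]? = some (omegaSeq (l + j)) := by
    rw [← getElem?_prefixStr hj, hy, List.getElem?_append_right (by omega), ← hl,
      Nat.add_sub_cancel_left]
  have h0 := key (5 * 5 ^ n * t) (by omega)
  have h1 := key (5 * 5 ^ n * t + 5 ^ n) (by omega)
  have h2 := hf.2 t (List.getElem?_eq_some_iff.1 h0).1
  rw [h0, h1] at h2
  simpa using h2

theorem getElem?_cStr_add_pow (n j : ℕ) (h : j < 9 * 5 ^ n) :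
    (cStr n)[5 ^ n + j]? = (cStr n)[j]? := by
  have h1 : cStr n = aStr n ++ (List.replicate 9 (aStr n)).flatten := rfl
  have h2 : cStr n = (List.replicate 9 (aStr n)).flatten ++ aStr n := by
    rw [cStr, List.replicate_succ', List.flatten_append, List.flatten_singleton]
  conv_lhs => rw [h1]
  conv_rhs => rw [h2]
  rw [List.getElem?_append_right (by rw [length_aStr]; omega), length_aStr,
    Nat.add_sub_cancel_left, List.getElem?_append_left (by
      rwa [length_flatten_replicate, length_aStr])]

theorem OccursAt.getElem? {A : Type*} {ω : ℕ → A} {x : List A} {i k : ℕ} (h : OccursAt ω x i)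
    (hk : k < x.length) : x[k]? = some (ω (i + k)) := by
  rw [OccursAt] at h
  conv_lhs => rw [← h]
  simp [seg, hk]

/-- For every `n > 0`, the string `cₙ` has no occurrence in `ω = c₀c₁c₂…` beginning at
any position `≥ l_{n+1} = |c₀c₁…cₙ|`. -/
theorem cStr_no_late_occurrence :
    ∀ n : ℕ, 0 < n → ∀ i : ℕ, (prefixStr (n + 1)).length ≤ i →
      ¬ OccursAt omegaSeq (cStr n) i := by
  intro n _ i hi hocc
  obtain ⟨d, rfl⟩ := Nat.exists_eq_add_of_le hi
  have hp : 0 < 5 ^ n := by positivity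
  set t := d / (5 * 5 ^ n) + 1 with ht
  have hdiv := Nat.div_add_mod d (5 * 5 ^ n)
  have hmod := Nat.mod_lt d (show 5 * 5 ^ n > 0 by omega)
  have htm : 5 * 5 ^ n * t = 5 * 5 ^ n * (d / (5 * 5 ^ n)) + 5 * 5 ^ n := by rw [ht]; ring
  obtain ⟨j, hj⟩ := Nat.exists_eq_add_of_le (show d ≤ 5 * 5 ^ n * t by omega)
  have hj5 : j ≤ 5 * 5 ^ n := by omega
  have h0 := hocc.getElem? (k := j) (by rw [length_cStr]; omega)
  have h1 := hocc.getElem? (k := 5 ^ n + j) (by rw [length_cStr]; omega)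
  have h2 := omegaSeq_add_pow n t
  rw [getElem?_cStr_add_pow n j (by omega), h0, Option.some_inj] at h1
  rw [hj, add_assoc d, add_comm j, ← add_assoc _ d, ← add_assoc _ d, ← h1] at h2
  simp at h2
end
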